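/- arXiv:2403.17791 — 4 statements merged into one kernel-verified Lean document; each statement's English description precedes it below -/
import Mathlib

section
/- Let X be a metric space and let γ, η : ℝ → X be curves such that γ(s) = η(s) for all s ≤ r, for some fixed r ∈ ℝ. Then for every t ≤ 0, ∫_ℝ e^{-2|s|}·dist(γ(s+t), η(s+t)) ds ≤ e^{max(-4r,0)} · e^{2t} · ∫_ℝ e^{-2|s|}·dist(γ(s), η(s)) ds. In particular, if r ≥ 0 the constant e^{max(-4r,0)} equals 1. -/
open MeasureTheory Real

/-- If two curves in a metric space agree for all times `s ≤ r`, then for every `t ≤ 0`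
the exponentially weighted distance between the time-`t` shifts is controlled:
`D(γ(·+t), η(·+t)) ≤ e^{max(-4r,0)} e^{2t} D(γ, η)`, where
`D(γ,η) = ∫ e^{-2|s|} dist(γ s, η s) ds` (valued in `[0,∞]`). -/
theorem weighted_dist_shift_past_agreement
    {X : Type*} [MetricSpace X] (γ η : ℝ → X) (r : ℝ)
    (hagree : ∀ s : ℝ, s ≤ r → γ s = η s) :
    ∀ t : ℝ, t ≤ 0 →
      (∫⁻ s : ℝ, ENNReal.ofReal (Real.exp (-2 * |s|) * dist (γ (s + t)) (η (s + t))))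
        ≤ ENNReal.ofReal (Real.exp (max (-4 * r) 0) * Real.exp (2 * t)) *
          ∫⁻ s : ℝ, ENNReal.ofReal (Real.exp (-2 * |s|) * dist (γ s) (η s)) := by
  intro t ht
  have h := lintegral_add_right_eq_self (μ := (volume : Measure ℝ))
    (fun u : ℝ => ENNReal.ofReal (Real.exp (-2 * |u - t|) * dist (γ u) (η u))) t
  simp only [add_sub_cancel_right] at h
  rw [h, ← lintegral_const_mul' _ _ ENNReal.ofReal_ne_top]
  refine lintegral_mono fun u => ?_
  rw [← ENNReal.ofReal_mul (by positivity)]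
  apply ENNReal.ofReal_le_ofReal
  rcases le_or_gt u r with hu | hu
  · simp [hagree u hu]
  · rw [← mul_assoc, ← Real.exp_add, ← Real.exp_add]
    refine mul_le_mul_of_nonneg_right (Real.exp_le_exp.mpr ?_) dist_nonneg
    have h1 := le_abs_self (u - t)
    have h2 := le_max_left (-4 * r) 0
    have h3 := le_max_right (-4 * r) 0
    rcases abs_cases u with ⟨h4, h5⟩ | ⟨h4, h5⟩ <;> rw [h4] <;> linarith
end

section
/- Let X be a metric space, δ ≥ 0, r ∈ ℝ, and let γ, η : ℝ → X be 1-Lipschitz curves such that γ(s) = η(s+δ) for all s ≥ r. Then for every t ≥ 0, ∫_ℝ e^{-2|s|}·dist(γ(s+t), η(s+t)) ds ≤ e^{max(4r,0)} · e^{2δ} · e^{-2t} · ∫_ℝ e^{-2|s|}·dist(γ(s), η(s)) ds + 2δ. -/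
open MeasureTheory Real

lemma lintegral_exp_abs_le :
    (∫⁻ s : ℝ, ENNReal.ofReal (Real.exp (-2 * |s|))) ≤ ENNReal.ofReal 2 := by
  have h1 : IntegrableOn (fun x : ℝ => Real.exp (-2 * x)) (Set.Ioi 0) :=
    integrableOn_exp_mul_Ioi (by norm_num) 0
  have h2 : IntegrableOn (fun x : ℝ => Real.exp (2 * x)) (Set.Iic 0) :=
    integrableOn_exp_mul_Iic (by norm_num) 0
  rw [← lintegral_add_compl _ (measurableSet_Iic (a := (0:ℝ))), Set.compl_Iic]
  have e2 : (∫⁻ s in Set.Iic (0:ℝ), ENNReal.ofReal (Real.exp (-2 * |s|)))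
      = ENNReal.ofReal (1/2) := by
    rw [setLIntegral_congr_fun (g := fun s => ENNReal.ofReal (Real.exp (2 * s)))
      measurableSet_Iic, ← ofReal_integral_eq_lintegral_ofReal h2
      (Filter.Eventually.of_forall fun _ => (Real.exp_pos _).le),
      integral_exp_mul_Iic (by norm_num)]
    · norm_num
    · intro x hx
      simp only [abs_of_nonpos (Set.mem_Iic.1 hx)]
      ring_nf
  have e1 : (∫⁻ s in Set.Ioi (0:ℝ), ENNReal.ofReal (Real.exp (-2 * |s|)))
      = ENNReal.ofReal (1/2) := by
    rw [setLIntegral_congr_fun (g := fun s => ENNReal.ofReal (Real.exp (-2 * s)))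
      measurableSet_Ioi, ← ofReal_integral_eq_lintegral_ofReal h1
      (Filter.Eventually.of_forall fun _ => (Real.exp_pos _).le),
      integral_exp_mul_Ioi (by norm_num)]
    · norm_num
    · intro x hx
      simp only [abs_of_pos (Set.mem_Ioi.1 hx)]
  rw [e1, e2, ← ENNReal.ofReal_add (by norm_num) (by norm_num)]
  exact ENNReal.ofReal_le_ofReal (by norm_num)

/-- If two `1`-Lipschitz curves in a metric space satisfy `γ s = η (s + δ)` for all `s ≥ r`,
then for every `t ≥ 0` the exponentially weighted distance between the time-`t` shifts
satisfies `D(γ(·+t), η(·+t)) ≤ e^{max(4r,0)} e^{2δ} e^{-2t} D(γ, η) + 2δ`, where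
`D(γ,η) = ∫ e^{-2|s|} dist(γ s, η s) ds` (valued in `[0,∞]`). -/
theorem weighted_dist_shift_future_agreement
    {X : Type*} [MetricSpace X] (γ η : ℝ → X) (δ r : ℝ)
    (hδ : 0 ≤ δ)
    (hγLip : ∀ s s' : ℝ, dist (γ s) (γ s') ≤ |s - s'|)
    (hηLip : ∀ s s' : ℝ, dist (η s) (η s') ≤ |s - s'|)
    (hagree : ∀ s : ℝ, r ≤ s → γ s = η (s + δ)) :
    ∀ t : ℝ, 0 ≤ t →
      (∫⁻ s : ℝ, ENNReal.ofReal (Real.exp (-2 * |s|) * dist (γ (s + t)) (η (s + t))))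
        ≤ ENNReal.ofReal (Real.exp (max (4 * r) 0) * Real.exp (2 * δ) * Real.exp (-2 * t)) *
            (∫⁻ s : ℝ, ENNReal.ofReal (Real.exp (-2 * |s|) * dist (γ s) (η s)))
          + ENNReal.ofReal (2 * δ) := by
  intro t ht
  have key : ∀ s : ℝ, ENNReal.ofReal (Real.exp (-2 * |s|) * dist (γ (s + t)) (η (s + t)))
      ≤ ENNReal.ofReal (Real.exp (max (4 * r) 0) * Real.exp (2 * δ) * Real.exp (-2 * t)) *
          ENNReal.ofReal (Real.exp (-2 * |s + t|) * dist (γ (s + t)) (η (s + t)))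
        + ENNReal.ofReal δ * ENNReal.ofReal (Real.exp (-2 * |s|)) := by
    intro s
    rw [← ENNReal.ofReal_mul (by positivity), ← ENNReal.ofReal_mul hδ,
      ← ENNReal.ofReal_add (by positivity) (by positivity)]
    apply ENNReal.ofReal_le_ofReal
    rcases le_or_gt r (s + t) with h | h
    · have h1 : dist (γ (s + t)) (η (s + t)) ≤ δ := by
        rw [hagree _ h]
        refine (hηLip _ _).trans ?_
        rw [add_sub_cancel_left, abs_of_nonneg hδ]
      have h2 := mul_le_mul_of_nonneg_left h1 (Real.exp_pos (-2 * |s|)).le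
      have h3 : 0 ≤ Real.exp (max (4 * r) 0) * Real.exp (2 * δ) * Real.exp (-2 * t) *
        (Real.exp (-2 * |s + t|) * dist (γ (s + t)) (η (s + t))) := by positivity
      linarith
    · have h1 : Real.exp (-2 * |s|) ≤ Real.exp (max (4 * r) 0) * Real.exp (2 * δ) *
          Real.exp (-2 * t) * Real.exp (-2 * |s + t|) := by
        rw [← Real.exp_add, ← Real.exp_add, ← Real.exp_add]
        apply Real.exp_le_exp.2
        have m1 := le_max_left (4 * r) 0
        have m2 := le_max_right (4 * r) 0
        have a1 := neg_le_abs s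
        rcases abs_cases (s + t) with ⟨h, _⟩ | ⟨h, _⟩ <;> rw [h] <;> linarith
      have h2 := mul_le_mul_of_nonneg_right h1 (dist_nonneg (x := γ (s + t)) (y := η (s + t)))
      have h3 : 0 ≤ δ * Real.exp (-2 * |s|) := by positivity
      linarith
  refine (lintegral_mono key).trans ?_
  rw [lintegral_add_right _ (by fun_prop), lintegral_const_mul' _ _ ENNReal.ofReal_ne_top,
    lintegral_const_mul' _ _ ENNReal.ofReal_ne_top,
    lintegral_add_right_eq_self
      (fun s => ENNReal.ofReal (Real.exp (-2 * |s|) * dist (γ s) (η s))) t]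
  gcongr
  rw [mul_comm (2:ℝ), ENNReal.ofReal_mul hδ]
  gcongr
  exact lintegral_exp_abs_le
end

section
/- Let X be a compact metric space, let (Φ_t)_{t∈ℝ} be a continuous flow on X, let λ : X → [0,∞) be lower semicontinuous, and let φ : X → ℝ be continuous. Define Sing := {x ∈ X : λ(Φ_t x) = 0 for all t ∈ ℝ}. Assume: (i) there is δ > 0 such that φ is constant on the set of points at distance less than δ from Sing; and (ii) for every c > 0, φ has the Bowen property on C(c) := {(x,t) ∈ X × [0,∞) : λ(x) ≥ c and λ(Φ_t x) ≥ c}, i.e. there exist ε > 0 and K ≥ 0 such that for every (x,t) ∈ C(c) and every y ∈ X with dist(Φ_r x, Φ_r y) ≤ ε for all r ∈ [0,t], one has |∫_0^t (φ(Φ_r x) − φ(Φ_r y)) dr| ≤ K. Then φ has the global Bowen property: there exist ε > 0 and K ≥ 0 such that for all x, y ∈ X and all t ≥ 0 with dist(Φ_r x, Φ_r y) ≤ ε for all r ∈ [0,t], one has |∫_0^t (φ(Φ_r x) − φ(Φ_r y)) dr| ≤ K. -/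
open Set MeasureTheory intervalIntegral

/-- Upgrading the non-uniform Bowen property to the global Bowen property.
Let `X` be a compact metric space with a continuous flow `Φ`, `λ : X → [0,∞)`
lower semicontinuous, and `φ : X → ℝ` continuous.  Let
`Sing = {x : λ(Φ_t x) = 0 for all t}`.  Assume `φ` is constant on a
`δ`-neighborhood of `Sing` and that `φ` has the Bowen property on
`C(c) = {(x,t) : λ(x) ≥ c and λ(Φ_t x) ≥ c}` for every `c > 0`.
Then `φ` has the global Bowen property. -/
theorem global_Bowen_property
    {X : Type*} [MetricSpace X] [CompactSpace X]
    (Φ : ℝ → X → X)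
    (hΦ0 : ∀ x, Φ 0 x = x)
    (hΦadd : ∀ t s x, Φ (t + s) x = Φ t (Φ s x))
    (hΦcont : Continuous (fun p : ℝ × X => Φ p.1 p.2))
    (lam : X → ℝ) (hlam_nonneg : ∀ x, 0 ≤ lam x)
    (hlam_lsc : LowerSemicontinuous lam)
    (φ : X → ℝ) (hφcont : Continuous φ)
    (hconst : ∃ δ > (0 : ℝ), ∀ x y : X,
      Metric.infDist x {z : X | ∀ t : ℝ, lam (Φ t z) = 0} < δ →
      Metric.infDist y {z : X | ∀ t : ℝ, lam (Φ t z) = 0} < δ →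
      φ x = φ y)
    (hBowenC : ∀ c > (0 : ℝ), ∃ ε > (0 : ℝ), ∃ K : ℝ, 0 ≤ K ∧
      ∀ x y : X, ∀ t : ℝ, 0 ≤ t → c ≤ lam x → c ≤ lam (Φ t x) →
        (∀ r ∈ Set.Icc (0 : ℝ) t, dist (Φ r x) (Φ r y) ≤ ε) →
        |∫ r in (0 : ℝ)..t, (φ (Φ r x) - φ (Φ r y))| ≤ K) :
    ∃ ε > (0 : ℝ), ∃ K : ℝ, 0 ≤ K ∧
      ∀ x y : X, ∀ t : ℝ, 0 ≤ t →
        (∀ r ∈ Set.Icc (0 : ℝ) t, dist (Φ r x) (Φ r y) ≤ ε) →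
        |∫ r in (0 : ℝ)..t, (φ (Φ r x) - φ (Φ r y))| ≤ K := by
  obtain ⟨δ, hδ, hc⟩ := hconst
  set S : Set X := {z : X | ∀ t : ℝ, lam (Φ t z) = 0} with hS
  have hflow : ∀ s, Continuous (Φ s) := fun s =>
    hΦcont.comp (continuous_const.prodMk continuous_id)
  have hA : IsCompact {x : X | δ / 2 ≤ Metric.infDist x S} :=
    (isClosed_le continuous_const (Metric.continuous_infDist_pt S)).isCompact
  obtain ⟨T, c, hT, hcpos, hTc⟩ : ∃ T c : ℝ, 0 ≤ T ∧ 0 < c ∧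
      ∀ x ∈ {x : X | δ / 2 ≤ Metric.infDist x S}, ∃ s, |s| ≤ T ∧ c ≤ lam (Φ s x) := by
    refine hA.induction_on (p := fun A => ∃ T c : ℝ, 0 ≤ T ∧ 0 < c ∧
      ∀ x ∈ A, ∃ s, |s| ≤ T ∧ c ≤ lam (Φ s x)) ?_ ?_ ?_ ?_
    · exact ⟨0, 1, le_rfl, one_pos, fun x hx => hx.elim⟩
    · rintro A B hAB ⟨T, c, h1, h2, h3⟩
      exact ⟨T, c, h1, h2, fun x hx => h3 x (hAB hx)⟩
    · rintro A B ⟨T, c, h1, h2, h3⟩ ⟨T', c', h1', h2', h3'⟩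
      refine ⟨max T T', min c c', le_max_of_le_left h1, lt_min h2 h2', ?_⟩
      rintro x (hx | hx)
      · obtain ⟨s, hs, hs'⟩ := h3 x hx
        exact ⟨s, le_max_of_le_left hs, (min_le_left _ _).trans hs'⟩
      · obtain ⟨s, hs, hs'⟩ := h3' x hx
        exact ⟨s, le_max_of_le_right hs, (min_le_right _ _).trans hs'⟩
    · intro x hx
      have hxS : x ∉ S := by
        intro h
        have h0 := Metric.infDist_zero_of_mem h
        have hx' : δ / 2 ≤ Metric.infDist x S := hx
        linarith
      have : ∃ s, lam (Φ s x) ≠ 0 := by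
        by_contra! h
        exact hxS h
      obtain ⟨s, hs⟩ := this
      have hpos : 0 < lam (Φ s x) := lt_of_le_of_ne (hlam_nonneg _) (Ne.symm hs)
      have hl := (hflow s).continuousAt.eventually (hlam_lsc (Φ s x) (lam (Φ s x) / 2) (by linarith))
      exact ⟨_, mem_nhdsWithin_of_mem_nhds hl, |s|, lam (Φ s x) / 2, abs_nonneg _, by linarith,
        fun z hz => ⟨s, le_rfl, le_of_lt hz⟩⟩
  obtain ⟨ε, hε, K, hK, hB⟩ := hBowenC c hcpos
  have huc := ((isCompact_Icc (a := -T) (b := T)).prod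
    (isCompact_univ (X := X))).uniformContinuousOn_of_continuous hΦcont.continuousOn
  rw [Metric.uniformContinuousOn_iff] at huc
  obtain ⟨η, hη, hu⟩ := huc ε hε
  have hu' : ∀ s u v, |s| ≤ T → dist u v < η → dist (Φ s u) (Φ s v) ≤ ε := by
    intro s u v hs huv
    have := hu (s, u) ⟨abs_le.1 hs, mem_univ _⟩ (s, v) ⟨abs_le.1 hs, mem_univ _⟩
      (by simpa [Prod.dist_eq] using huv)
    exact this.le
  obtain ⟨M, hM⟩ := (isCompact_univ (X := X)).exists_bound_of_continuousOn hφcont.continuousOn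
  refine ⟨min (η / 2) (δ / 2), by positivity, K + 8 * |M| * T, by positivity, ?_⟩
  intro x y t ht hxy
  set f : ℝ → ℝ := fun r => φ (Φ r x) - φ (Φ r y) with hf
  have horb : ∀ z, Continuous fun r => Φ r z := fun z =>
    hΦcont.comp (continuous_id.prodMk continuous_const)
  have hfc : Continuous f := (hφcont.comp (horb x)).sub (hφcont.comp (horb y))
  have hfi : ∀ a b, IntervalIntegrable f volume a b := fun a b => hfc.intervalIntegrable a b
  have hfb : ∀ r, ‖f r‖ ≤ 2 * |M| := by
    intro r
    have h1 := hM (Φ r x) (mem_univ _)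
    have h2 := hM (Φ r y) (mem_univ _)
    have h3 := norm_sub_le (φ (Φ r x)) (φ (Φ r y))
    have := le_abs_self M
    simp only [hf]
    linarith
  have hint : ∀ a b, |∫ r in a..b, f r| ≤ 2 * |M| * |b - a| := fun a b =>
    intervalIntegral.norm_integral_le_of_norm_le_const fun r _ => hfb r
  have hf0 : ∀ r ∈ Icc 0 t, Metric.infDist (Φ r x) S < δ / 2 → f r = 0 := by
    intro r hr h
    have h1 := (hxy r hr).trans (min_le_right _ _)
    have h2 : Metric.infDist (Φ r y) S ≤ Metric.infDist (Φ r x) S + dist (Φ r y) (Φ r x) :=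
      Metric.infDist_le_infDist_add_dist
    rw [dist_comm] at h2
    exact sub_eq_zero.2 (hc _ _ (by linarith) (by linarith))
  have hext : ∀ r, -T ≤ r → r ≤ t + T → dist (Φ r x) (Φ r y) ≤ ε := by
    intro r h1 h2
    obtain ⟨r', hr', hd⟩ : ∃ r' ∈ Icc 0 t, |r - r'| ≤ T := by
      by_cases h0 : r < 0
      · exact ⟨0, ⟨le_rfl, ht⟩, by rw [abs_le]; constructor <;> linarith⟩
      by_cases h3 : t < r
      · exact ⟨t, ⟨ht, le_rfl⟩, by rw [abs_le]; constructor <;> linarith⟩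
      · exact ⟨r, ⟨not_lt.1 h0, not_lt.1 h3⟩, by simpa using hT⟩
    have h3 := (hxy r' hr').trans (min_le_left _ _)
    have h4 := hu' (r - r') _ _ hd (by linarith : dist (Φ r' x) (Φ r' y) < η)
    rwa [← hΦadd, ← hΦadd, sub_add_cancel] at h4
  have hRc : IsCompact (Icc 0 t ∩ {r | δ / 2 ≤ Metric.infDist (Φ r x) S}) :=
    isCompact_Icc.inter_right
      (isClosed_le continuous_const ((Metric.continuous_infDist_pt S).comp (horb x)))
  have hz : ∀ a b, a ≤ b → (∀ r ∈ Ioo a b, f r = 0) → ∫ r in a..b, f r = 0 := by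
    intro a b hab h
    rw [intervalIntegral.integral_of_le hab, integral_Ioc_eq_integral_Ioo]
    exact setIntegral_eq_zero_of_forall_eq_zero h
  rcases eq_empty_or_nonempty (Icc 0 t ∩ {r | δ / 2 ≤ Metric.infDist (Φ r x) S}) with hR | hR
  · rw [hz 0 t ht]
    · rw [abs_zero]; positivity
    · intro r hr
      refine hf0 r (Ioo_subset_Icc_self hr) ?_
      by_contra! h
      exact (hR ▸ (⟨Ioo_subset_Icc_self hr, h⟩ : r ∈ Icc 0 t ∩ {r | δ / 2 ≤ Metric.infDist (Φ r x) S}) : r ∈ (∅ : Set ℝ))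
  obtain ⟨a, ⟨ha, ha'⟩, hamin⟩ := hRc.exists_isLeast hR
  obtain ⟨b, ⟨hb, hb'⟩, hbmax⟩ := hRc.exists_isGreatest hR
  have hab : a ≤ b := hamin ⟨hb, hb'⟩
  have h0a : ∫ r in 0..a, f r = 0 := by
    refine hz _ _ ha.1 fun r hr => ?_
    have hrt : r ∈ Icc 0 t := ⟨hr.1.le, hr.2.le.trans ha.2⟩
    refine hf0 r hrt ?_
    by_contra! h
    exact absurd (hamin ⟨hrt, h⟩) (not_le.2 hr.2)
  have hbt : ∫ r in b..t, f r = 0 := by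
    refine hz _ _ hb.2 fun r hr => ?_
    have hrt : r ∈ Icc 0 t := ⟨hb.1.trans hr.1.le, hr.2.le⟩
    refine hf0 r hrt ?_
    by_contra! h
    exact absurd (hbmax ⟨hrt, h⟩) (not_le.2 hr.1)
  obtain ⟨s, hs, hsl⟩ := hTc _ ha'
  obtain ⟨s', hs', hsl'⟩ := hTc _ hb'
  rw [← hΦadd] at hsl hsl'
  have e1 := abs_le.1 hs
  have e2 := abs_le.1 hs'
  have hmid : |∫ r in (s + a)..(s' + b), f r| ≤ K + 4 * |M| * T := by
    have hMT : 0 ≤ |M| * T := by positivity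
    rcases le_total (s + a) (s' + b) with hpq | hpq
    · have := hB (Φ (s + a) x) (Φ (s + a) y) (s' + b - (s + a)) (by linarith) hsl
        (by rwa [← hΦadd, sub_add_cancel]) (by
          intro r hr
          rw [← hΦadd, ← hΦadd]
          exact hext _ (by linarith [hr.1, ha.1]) (by linarith [hr.2, hb.2]))
      simp only [← hΦadd] at this
      have h5 := intervalIntegral.integral_comp_add_right (a := 0) (b := s' + b - (s + a)) f (s + a)
      rw [zero_add, sub_add_cancel] at h5
      rw [← h5]
      simp only [hf]
      linarith
    · have h6 := hint (s + a) (s' + b)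
      have h7 : |s' + b - (s + a)| ≤ 2 * T := by
        rw [abs_le]; constructor <;> linarith
      have h8 := mul_le_mul_of_nonneg_left h7 (by positivity : 0 ≤ 2 * |M|)
      linarith
  have g1 : |∫ r in a..(s + a), f r| ≤ 2 * |M| * T :=
    (hint _ _).trans (mul_le_mul_of_nonneg_left (by simpa using hs) (by positivity))
  have g2 : |∫ r in (s' + b)..b, f r| ≤ 2 * |M| * T :=
    (hint _ _).trans (mul_le_mul_of_nonneg_left (by simpa using hs') (by positivity))
  have hsum : ∫ r in 0..t, f r = (∫ r in a..(s + a), f r) + (∫ r in (s + a)..(s' + b), f r)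
      + ∫ r in (s' + b)..b, f r := by
    rw [intervalIntegral.integral_add_adjacent_intervals (hfi _ _) (hfi _ _),
      intervalIntegral.integral_add_adjacent_intervals (hfi _ _) (hfi _ _),
      ← intervalIntegral.integral_add_adjacent_intervals (hfi 0 a) (hfi a t), h0a,
      ← intervalIntegral.integral_add_adjacent_intervals (hfi a b) (hfi b t), hbt]
    ring
  rw [hsum]
  rw [abs_le] at *
  constructor <;> linarith [g1.1, g1.2, g2.1, g2.2, hmid.1, hmid.2]
end

section
/- Let (X, 𝒜, μ) be a finite measure space and let (Φ_t)_{t∈ℝ} be a measure-preserving flow on X (each Φ_t is a measurable bijection with measurable inverse and μ(Φ_t^{-1} A) = μ(A) for all A ∈ 𝒜). Let M > 0 and let D ∈ 𝒜 be such that Φ_t(D) ∩ Φ_s(D) = ∅ for all distinct t, s ∈ [-M, M], and such that Φ_{[a,b]}(D) := ⋃_{t∈[a,b]} Φ_t(D) is measurable for every subinterval [a,b] ⊆ [-M, M]. Then for all a < b and a' < b' in [-M, M]: (b' − a') · μ(Φ_{[a,b]}(D)) = (b − a) · μ(Φ_{[a',b']}(D)). -/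
open Set MeasureTheory

lemma cauchy_aux (f : ℝ → ℝ) (L : ℝ) (h0 : ∀ x, 0 ≤ f x)
    (hadd : ∀ x y, 0 ≤ x → 0 ≤ y → x + y ≤ L → f (x + y) = f x + f y)
    (x y : ℝ) (hx : 0 < x) (hy : 0 < y) (hxL : x ≤ L) (hyL : y ≤ L) :
    y * f x ≤ x * f y := by
  have hf0 : f 0 = 0 := by
    have := hadd 0 0 le_rfl le_rfl (by linarith)
    simp at this
    exact this
  have hmul : ∀ d : ℝ, 0 ≤ d → ∀ k : ℕ, (k : ℝ) * d ≤ L → f (k * d) = k * f d := by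
    intro d hd k
    induction k with
    | zero => intro _; simp [hf0]
    | succ k ih =>
      intro hk
      push_cast at hk ⊢
      have h1 : ((k : ℝ) + 1) * d = k * d + d := by ring
      rw [h1] at hk ⊢
      rw [hadd _ _ (by positivity) hd hk, ih (by linarith)]
      ring
  have key : ∀ n : ℕ, y * f x ≤ x * f y + (y * f y) * (1 / ((n : ℝ) + 1)) := by
    intro n
    have hn : (0 : ℝ) < (n : ℝ) + 1 := by positivity
    obtain ⟨d, hd⟩ : ∃ d, d = y / ((n : ℝ) + 1) := ⟨_, rfl⟩
    have hdpos : 0 < d := by rw [hd]; positivity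
    have hyd : y = ((n + 1 : ℕ) : ℝ) * d := by rw [hd]; push_cast; field_simp
    have hfy : f y = ((n : ℝ) + 1) * f d := by
      have := hmul d hdpos.le (n + 1) (by rw [← hyd]; exact hyL)
      rw [← hyd] at this
      rw [this]; push_cast; ring
    obtain ⟨k, hk⟩ : ∃ k, k = ⌊x / d⌋₊ := ⟨_, rfl⟩
    have hk1 : (k : ℝ) * d ≤ x := by
      have := Nat.floor_le (show 0 ≤ x / d by positivity)
      rw [← hk] at this
      rwa [le_div_iff₀ hdpos] at this
    have hk2 : x < ((k : ℝ) + 1) * d := by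
      have := Nat.lt_floor_add_one (x / d)
      rw [← hk] at this
      rwa [div_lt_iff₀ hdpos] at this
    have hdy : d ≤ y := by
      rw [hd]; apply div_le_self hy.le; linarith [(Nat.cast_nonneg n : (0 : ℝ) ≤ n)]
    have hrem : f (x - k * d) ≤ f d := by
      have := hadd (x - k * d) (d - (x - k * d)) (by linarith) (by linarith) (by linarith)
      rw [show x - k * d + (d - (x - k * d)) = d by ring] at this
      linarith [h0 (d - (x - k * d))]
    have hfx : f x ≤ k * f d + f d := by
      have := hadd (k * d) (x - k * d) (by positivity) (by linarith) (by linarith)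
      rw [show k * d + (x - k * d) = x by ring, hmul d hdpos.le k (by linarith)] at this
      linarith
    have e1 : y * f y * (1 / ((n : ℝ) + 1)) = y * f d := by rw [hfy]; field_simp
    rw [e1]
    have e2 : x * f y ≥ y * (k * f d) := by
      rw [hfy, hyd]; push_cast
      have := mul_le_mul_of_nonneg_right hk1 (mul_nonneg hn.le (h0 d))
      nlinarith
    have e3 := mul_le_mul_of_nonneg_left hfx hy.le
    linarith
  have hlim := (tendsto_one_div_add_atTop_nhds_zero_nat (𝕜 := ℝ)).const_mul (y * f y)
  have hlim2 := hlim.const_add (x * f y)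
  simp only [mul_zero, add_zero] at hlim2
  exact ge_of_tendsto' hlim2 key

/-- For a measure-preserving flow and a set `D` whose translates `Φ_t(D)`,
`t ∈ [-M, M]`, are pairwise disjoint (with the tube over each subinterval
measurable), the measure of the tube `Φ_{[a,b]}(D)` is proportional to the
length `b - a`:  `(b'-a') μ(Φ_{[a,b]} D) = (b-a) μ(Φ_{[a',b']} D)`. -/
theorem flow_tube_measure_proportional
    {X : Type*} [MeasurableSpace X] (μ : Measure X) [IsFiniteMeasure μ]
    (Φ : ℝ → X → X)
    (hΦ0 : ∀ x, Φ 0 x = x)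
    (hΦadd : ∀ t s x, Φ (t + s) x = Φ t (Φ s x))
    (hΦmeas : ∀ t : ℝ, Measurable (Φ t))
    (hΦpres : ∀ t : ℝ, ∀ A : Set X, MeasurableSet A → μ (Φ t ⁻¹' A) = μ A)
    (M : ℝ) (hM : 0 < M)
    (D : Set X) (hD : MeasurableSet D)
    (hdisj : ∀ t ∈ Set.Icc (-M) M, ∀ s ∈ Set.Icc (-M) M, t ≠ s →
      Disjoint (Φ t '' D) (Φ s '' D))
    (htube_meas : ∀ a b : ℝ, -M ≤ a → a ≤ b → b ≤ M →
      MeasurableSet (⋃ t ∈ Set.Icc a b, Φ t '' D)) :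
    ∀ a b a' b' : ℝ, -M ≤ a → a < b → b ≤ M → -M ≤ a' → a' < b' → b' ≤ M →
      ENNReal.ofReal (b' - a') * μ (⋃ t ∈ Set.Icc a b, Φ t '' D) =
      ENNReal.ofReal (b - a) * μ (⋃ t ∈ Set.Icc a' b', Φ t '' D) := by
  have himg : ∀ t : ℝ, ∀ A : Set X, Φ t '' A = Φ (-t) ⁻¹' A := by
    intro t A
    ext x
    constructor
    · rintro ⟨y, hy, rfl⟩
      simp only [mem_preimage, ← hΦadd, neg_add_cancel, hΦ0]
      exact hy
    · intro hx
      exact ⟨Φ (-t) x, hx, by rw [← hΦadd, add_neg_cancel, hΦ0]⟩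
  have hmeasD : ∀ t, MeasurableSet (Φ t '' D) := by
    intro t
    rw [himg]
    exact hΦmeas _ hD
  have hμD : ∀ t, μ (Φ t '' D) = μ D := by
    intro t
    rw [himg]
    exact hΦpres _ _ hD
  have hzero : μ D = 0 := by
    by_contra hne
    let s : ℕ → ℝ := fun n => M * (1 / ((n : ℝ) + 1))
    have hs : ∀ n, s n ∈ Icc (-M) M := by
      intro n
      have h1 : (0 : ℝ) < 1 / ((n : ℝ) + 1) := by positivity
      have h2 : 1 / ((n : ℝ) + 1) ≤ 1 := by
        rw [div_le_one (by positivity)]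
        linarith [(Nat.cast_nonneg n : (0 : ℝ) ≤ n)]
      constructor
      · have : 0 < s n := mul_pos hM h1
        linarith
      · exact mul_le_of_le_one_right hM.le h2
    have hinj : ∀ i j, i ≠ j → s i ≠ s j := by
      intro i j hij h
      apply hij
      have h3 := mul_left_cancel₀ hM.ne' h
      have h4 : ((i : ℝ) + 1) = j + 1 := by
        simpa using h3
      exact_mod_cast add_right_cancel h4
    have hu := measure_iUnion (μ := μ) (f := fun n : ℕ => Φ (s n) '' D)
      (fun i j hij => hdisj _ (hs i) _ (hs j) (hinj i j hij)) (fun n => hmeasD _)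
    simp only [hμD] at hu
    rw [ENNReal.tsum_const_eq_top_of_ne_zero hne] at hu
    exact measure_ne_top μ _ hu
  let T : ℝ → ℝ → Set X := fun a b => ⋃ t ∈ Set.Icc a b, Φ t '' D
  have hTmem : ∀ a b x, x ∈ T a b ↔ ∃ t ∈ Set.Icc a b, x ∈ Φ t '' D := by
    intro a b x
    simp only [T, mem_iUnion, exists_prop]
  have hTshift : ∀ a b c, T (a + c) (b + c) = Φ (-c) ⁻¹' T a b := by
    intro a b c
    ext x
    rw [mem_preimage, hTmem, hTmem]
    constructor
    · rintro ⟨t, ⟨h1, h2⟩, y, hy, rfl⟩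
      refine ⟨t - c, ⟨by linarith, by linarith⟩, y, hy, ?_⟩
      rw [← hΦadd]; congr 1; ring
    · rintro ⟨t, ⟨h1, h2⟩, y, hy, h⟩
      refine ⟨t + c, ⟨by linarith, by linarith⟩, y, hy, ?_⟩
      rw [add_comm, hΦadd, h, ← hΦadd, add_neg_cancel, hΦ0]
  have hTshiftμ : ∀ a b c, -M ≤ a → a ≤ b → b ≤ M → μ (T (a + c) (b + c)) = μ (T a b) := by
    intro a b c h1 h2 h3
    rw [hTshift]
    exact hΦpres _ _ (htube_meas a b h1 h2 h3)
  have hTadd : ∀ a b c, -M ≤ a → a ≤ b → b ≤ c → c ≤ M →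
      μ (T a c) = μ (T a b) + μ (T b c) := by
    intro a b c h1 h2 h3 h4
    have hU : T a c = T a b ∪ T b c := by
      simp only [T]
      rw [← Icc_union_Icc_eq_Icc h2 h3, biUnion_union]
    rw [hU]
    apply measure_union₀ (htube_meas b c (by linarith) h3 h4).nullMeasurableSet
    refine measure_mono_null ?_ ((hμD b).trans hzero)
    rintro x ⟨hx1, hx2⟩
    obtain ⟨t, ht, hxt⟩ := (hTmem _ _ _).1 hx1
    obtain ⟨s, hs, hxs⟩ := (hTmem _ _ _).1 hx2
    have hts : t = s := by
      by_contra hne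
      exact Set.disjoint_left.1 (hdisj t ⟨by linarith [ht.1], by linarith [ht.2]⟩ s
        ⟨by linarith [hs.1], by linarith [hs.2]⟩ hne) hxt hxs
    have htb : t = b := le_antisymm ht.2 (hts ▸ hs.1)
    rwa [htb] at hxt
  let f : ℝ → ℝ := fun h => (μ (T (-M) (-M + h))).toReal
  have hf : ∀ a b, -M ≤ a → a ≤ b → b ≤ M → μ (T a b) = ENNReal.ofReal (f (b - a)) := by
    intro a b h1 h2 h3
    simp only [f]
    rw [ENNReal.ofReal_toReal (measure_ne_top _ _), ← hTshiftμ a b (-M - a) h1 h2 h3]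
    congr 2 <;> ring
  have hfnn : ∀ x, 0 ≤ f x := fun x => ENNReal.toReal_nonneg
  have hfadd : ∀ x y, 0 ≤ x → 0 ≤ y → x + y ≤ 2 * M → f (x + y) = f x + f y := by
    intro x y hx hy hxy
    have h1 := hTadd (-M) (-M + x) (-M + (x + y)) le_rfl (by linarith) (by linarith) (by linarith)
    rw [hf (-M + x) (-M + (x + y)) (by linarith) (by linarith) (by linarith),
      show -M + (x + y) - (-M + x) = y by ring] at h1
    simp only [f] at h1 ⊢
    rw [h1, ENNReal.toReal_add (measure_ne_top _ _) ENNReal.ofReal_ne_top,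
      ENNReal.toReal_ofReal ENNReal.toReal_nonneg]
  intro a b a' b' h1 h2 h3 h4 h5 h6
  have e1 := hf a b h1 h2.le h3
  have e2 := hf a' b' h4 h5.le h6
  simp only [T] at e1 e2
  rw [e1, e2, ← ENNReal.ofReal_mul (by linarith), ← ENNReal.ofReal_mul (by linarith)]
  congr 1
  apply le_antisymm
  · exact cauchy_aux f (2 * M) hfnn hfadd _ _ (by linarith) (by linarith) (by linarith) (by linarith)
  · exact cauchy_aux f (2 * M) hfnn hfadd _ _ (by linarith) (by linarith) (by linarith) (by linarith)
end
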